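/- arXiv:2206.13461 — 8 statements merged into one kernel-verified Lean document; each statement's English description precedes it below -/
import Mathlib

section
/- For all z, w in the hyperbolic upper half-plane, B (ι z) (ι w) = − Real.cosh (dist z w). In particular B (ι z) (ι z) = −1 for every z. -/
open UpperHalfPlane

/-- The Minkowski bilinear form of signature (2,1) on ℝ³. -/
def B (x y : Fin 3 → ℝ) : ℝ := -(x 0 * y 0) + x 1 * y 1 + x 2 * y 2

/-- The Minkowski lift of a point of the hyperbolic upper half-plane to the
hyperboloid `B x x = -1`. -/
noncomputable def ι (z : UpperHalfPlane) : Fin 3 → ℝ :=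
  ![(1 + (z.re ^ 2 + z.im ^ 2)) / (2 * z.im), z.re / z.im,
    (1 - (z.re ^ 2 + z.im ^ 2)) / (2 * z.im)]

theorem B_ι_ι (z w : UpperHalfPlane) : B (ι z) (ι w) = -Real.cosh (dist z w) := by
  have hz := z.im_ne_zero
  have hw := w.im_ne_zero
  simp only [B, ι, UpperHalfPlane.cosh_dist', Matrix.cons_val]
  field_simp
  ring

/-- Point–point case of the paper's Lemma 2.8: the Minkowski pairing of the lifts of two
points of the hyperbolic plane is minus the hyperbolic cosine of their distance; in
particular each lift has Minkowski norm −1. -/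
theorem minkowski_pairing_of_lifts :
    (∀ z w : UpperHalfPlane, B (ι z) (ι w) = -Real.cosh (dist z w)) ∧
      ∀ z : UpperHalfPlane, B (ι z) (ι z) = -1 :=
  ⟨B_ι_ι, fun z ↦ by rw [B_ι_ι, dist_self, Real.cosh_zero]⟩
end

section
/- Fix t > 0 and let S_t := (t, 0, −t) ∈ Fin 3 → ℝ. Then for every z in the hyperbolic upper half-plane: (1) −B S_t (ι z) = t / im z, and (2) the hyperbolic distance from z to the horocycle {w ∈ UpperHalfPlane : im w = t} equals |Real.log (t / im z)|, i.e. Metric.infDist z {w : im w = t} = |Real.log (t / im z)|. -/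
open UpperHalfPlane

/-- Horocycle instance of the paper's Lemma 2.7/2.8: pairing the isotropic
representative `S_t = (t, 0, −t)` of the horocycle `{im w = t}` with the lift of a
point `z` gives `t / im z = e^{δ}` where `δ` is the signed distance from `z` to the
horocycle; in particular the hyperbolic distance from `z` to the horocycle is
`|log (t / im z)|`. -/
theorem horocycle_pairing_and_dist (t : ℝ) (ht : 0 < t) (z : UpperHalfPlane) :
    -B ![t, 0, -t] (ι z) = t / z.im ∧
      Metric.infDist z {w : UpperHalfPlane | w.im = t} = |Real.log (t / z.im)| := by
  constructor
  · have hz := z.im_ne_zero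
    simp only [B, ι, Matrix.cons_val]
    field_simp
    ring
  · have habs : |Real.log (t / z.im)| = dist (Real.log z.im) (Real.log t) := by
      rw [dist_comm, Real.dist_eq, Real.log_div ht.ne' z.im_ne_zero]
    let foot : UpperHalfPlane := ⟨⟨z.re, t⟩, ht⟩
    have hfoot : foot ∈ {w : UpperHalfPlane | w.im = t} := rfl
    rw [habs]
    apply le_antisymm
    · exact (Metric.infDist_le_dist_of_mem hfoot).trans_eq
        (UpperHalfPlane.dist_of_re_eq (w := foot) rfl)
    · rw [Metric.le_infDist ⟨foot, hfoot⟩]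
      rintro w rfl
      exact UpperHalfPlane.dist_log_im_le z w
end

section
/- Let c₁, c₂ be points of the hyperbolic upper half-plane and r₁, r₂ > 0 with dist c₁ c₂ > |r₁ − r₂|. Then there exists a point x ∈ UpperHalfPlane with x ≠ c₂, lying on the geodesic ray from c₂ through c₁ (i.e. dist c₂ x + dist x c₁ = dist c₂ c₁, or dist c₂ x = dist c₂ c₁ + dist c₁ x), and satisfying Real.cosh (dist x c₁) · Real.cosh r₂ = Real.cosh (dist x c₂) · Real.cosh r₁, if and only if Real.cosh r₁ < Real.cosh r₂ · Real.cosh (dist c₁ c₂). -/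
open UpperHalfPlane

namespace UpperHalfPlane

/-- If `u` is the combination `p • z + q • w` in the hyperboloid model, then pairing it with `z`
gives `cosh (dist u z)`. -/
theorem cosh_dist_of_combination (u z w : ℍ) {p q : ℝ}
    (hpq : p ^ 2 + q ^ 2 + 2 * p * q * Real.cosh (dist z w) = 1)
    (him : 1 / u.im = p / z.im + q / w.im)
    (hre : u.re / u.im = p * z.re / z.im + q * w.re / w.im) :
    Real.cosh (dist u z) = p + q * Real.cosh (dist z w) := by
  have hu := u.im_ne_zero
  have hz := z.im_ne_zero
  have hw := w.im_ne_zero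
  rw [div_add_div _ _ hz hw, div_eq_div_iff hu (mul_ne_zero hz hw)] at him
  rw [div_add_div _ _ hz hw, div_eq_div_iff hu (mul_ne_zero hz hw)] at hre
  have hdiff : (u.re - z.re) * w.im = u.im * q * (w.re - z.re) := by
    apply mul_left_cancel₀ hz
    linear_combination hre - z.re * him
  have hsq : (w.re - z.re) ^ 2 =
      2 * z.im * w.im * Real.cosh (dist z w) - z.im ^ 2 - w.im ^ 2 := by
    rw [cosh_dist']
    field_simp
    ring
  have hsq' : (u.re - z.re) ^ 2 * w.im ^ 2 = u.im ^ 2 * q ^ 2 *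
      (2 * z.im * w.im * Real.cosh (dist z w) - z.im ^ 2 - w.im ^ 2) := by
    rw [← hsq, ← mul_pow, hdiff]
    ring
  rw [cosh_dist' u z, div_eq_iff (by positivity)]
  generalize Real.cosh (dist z w) = K at *
  apply mul_right_cancel₀ (pow_ne_zero 2 hw)
  linear_combination hsq' - u.im ^ 2 * w.im ^ 2 * hpq +
    (z.im * w.im - u.im * p * w.im + u.im * q * z.im - 2 * q * K * u.im * w.im) * him

/-- The combination `p • z + q • w` in the hyperboloid model, when it lies on the upper sheet. -/
theorem exists_cosh_dist_eq_of_combination (z w : ℍ) {p q : ℝ}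
    (hpq : p ^ 2 + q ^ 2 + 2 * p * q * Real.cosh (dist z w) = 1)
    (hpos : 0 < p / z.im + q / w.im) :
    ∃ u : ℍ, Real.cosh (dist u z) = p + q * Real.cosh (dist z w) ∧
      Real.cosh (dist u w) = p * Real.cosh (dist z w) + q := by
  let u : ℍ := ⟨⟨(p * z.re / z.im + q * w.re / w.im) / (p / z.im + q / w.im),
    1 / (p / z.im + q / w.im)⟩, by simpa using hpos⟩
  have him : 1 / u.im = p / z.im + q / w.im := one_div_one_div _
  have hre : u.re / u.im = p * z.re / z.im + q * w.re / w.im := by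
    rw [div_eq_mul_one_div, him]
    exact div_mul_cancel₀ _ hpos.ne'
  refine ⟨u, cosh_dist_of_combination u z w hpq him hre, ?_⟩
  rw [dist_comm z w] at hpq ⊢
  rw [cosh_dist_of_combination u w z (p := q) (q := p) (by linarith) (by linarith) (by linarith)]
  ring

/-- The point at distance `t` from `z` on the geodesic ray from `z` through `w`. -/
theorem exists_dist_eq_and_dist_eq_abs_sub {z w : ℍ} (hzw : z ≠ w) {t : ℝ} (ht : 0 ≤ t) :
    ∃ u : ℍ, dist u z = t ∧ dist u w = |dist z w - t| := by
  have hd : 0 < dist z w := dist_pos.2 hzw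
  have hS : 0 < Real.sinh (dist z w) := Real.sinh_pos_iff.2 hd
  have hw := im_le_im_mul_exp_dist w z
  rw [dist_comm w z] at hw
  generalize hdd : dist z w = d at *
  have hsub := Real.sinh_sub d t
  have hcsub := Real.cosh_sub d t
  have hpos : 0 < Real.sinh (d - t) / Real.sinh d / z.im + Real.sinh t / Real.sinh d / w.im := by
    have key : 0 < Real.sinh (d - t) * w.im + Real.sinh t * z.im := by
      rcases le_or_gt t d with h | h
      · rcases h.eq_or_lt with rfl | h
        · have := z.im_pos
          simp only [sub_self, Real.sinh_zero]
          positivity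
        · have h1 : 0 < Real.sinh (d - t) := Real.sinh_pos_iff.2 (by linarith)
          have h2 : 0 ≤ Real.sinh t := Real.sinh_nonneg_iff.2 ht
          have := z.im_pos
          have := w.im_pos
          positivity
      · have h1 : Real.sinh (d - t) < 0 := Real.sinh_neg_iff.2 (by linarith)
        have h2 : Real.sinh (d - t) * Real.exp d + Real.sinh t = Real.sinh d * Real.exp (d - t) := by
          rw [hsub, sub_eq_add_neg d t, Real.exp_add, ← Real.cosh_add_sinh d,
            ← Real.cosh_sub_sinh t]
          linear_combination -Real.sinh t * Real.cosh_sq d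
        have h3 : 0 < Real.sinh d * Real.exp (d - t) := by positivity
        nlinarith [mul_le_mul_of_nonpos_left hw h1.le, mul_pos z.im_pos h3]
    have e : Real.sinh (d - t) / Real.sinh d / z.im + Real.sinh t / Real.sinh d / w.im =
        (Real.sinh (d - t) * w.im + Real.sinh t * z.im) / (Real.sinh d * z.im * w.im) := by
      have := z.im_ne_zero
      have := w.im_ne_zero
      field_simp
    have := z.im_pos
    have := w.im_pos
    rw [e]
    positivity
  have hpq : (Real.sinh (d - t) / Real.sinh d) ^ 2 + (Real.sinh t / Real.sinh d) ^ 2 +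
      2 * (Real.sinh (d - t) / Real.sinh d) * (Real.sinh t / Real.sinh d) *
        Real.cosh (dist z w) = 1 := by
    rw [hdd, hsub]
    field_simp
    have := Real.cosh_sq d
    have := Real.cosh_sq t
    grind
  obtain ⟨u, hu, hu'⟩ := exists_cosh_dist_eq_of_combination z w hpq hpos
  refine ⟨u, ?_, ?_⟩
  · apply Real.cosh_injOn dist_nonneg ht
    rw [hu, hdd, hsub]
    field_simp
    ring
  · apply Real.cosh_injOn dist_nonneg (abs_nonneg (d - t))
    rw [hu', hdd, hsub, Real.cosh_abs, hcsub]
    field_simp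
    linear_combination -Real.sinh t * Real.cosh_sq d

end UpperHalfPlane

/-- Shifting the argument changes `cosh` by at most an exponential factor. -/
theorem Real.cosh_le_cosh_mul_exp_abs_sub (a b : ℝ) :
    Real.cosh a ≤ Real.cosh b * Real.exp |b - a| := by
  have h1 : Real.exp a ≤ Real.exp b * Real.exp |b - a| := by
    rw [← Real.exp_add, Real.exp_le_exp]
    linarith [neg_abs_le (b - a)]
  have h2 : Real.exp (-a) ≤ Real.exp (-b) * Real.exp |b - a| := by
    rw [← Real.exp_add, Real.exp_le_exp]
    linarith [le_abs_self (b - a)]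
  rw [Real.cosh_eq, Real.cosh_eq]
  linarith

/-- The paper's Corollary 2.13 (circle–circle case): the radical line of two hyperbolic
circles meets the geodesic ray starting at `c₂` and extending towards `c₁` if and only
if `cosh r₁ / cosh r₂ < cosh (dist c₁ c₂)`. -/
theorem radical_line_meets_ray_iff (c₁ c₂ : UpperHalfPlane) (r₁ r₂ : ℝ)
    (h₁ : 0 < r₁) (h₂ : 0 < r₂) (h : dist c₁ c₂ > |r₁ - r₂|) :
    (∃ x : UpperHalfPlane, x ≠ c₂ ∧
        (dist c₂ x + dist x c₁ = dist c₂ c₁ ∨ dist c₂ x = dist c₂ c₁ + dist c₁ x) ∧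
        Real.cosh (dist x c₁) * Real.cosh r₂ = Real.cosh (dist x c₂) * Real.cosh r₁) ↔
      Real.cosh r₁ < Real.cosh r₂ * Real.cosh (dist c₁ c₂) := by
  have hd : 0 < dist c₂ c₁ := by rw [dist_comm]; exact (abs_nonneg _).trans_lt h
  have hS : 0 < Real.sinh (dist c₂ c₁) := Real.sinh_pos_iff.2 hd
  rw [dist_comm c₁ c₂] at h ⊢
  constructor
  · rintro ⟨x, hx, hray, heq⟩
    rw [dist_comm c₂ x, dist_comm c₁ x] at hray
    have ht : 0 < dist x c₂ := dist_pos.2 hx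
    have hcosh : Real.cosh (dist x c₁) = Real.cosh (dist c₂ c₁ - dist x c₂) := by
      rcases hray with hray | hray
      · rw [← hray, add_sub_cancel_left]
      · rw [hray, sub_add_cancel_left, Real.cosh_neg]
    rw [hcosh, Real.cosh_sub] at heq
    have hpos : 0 < Real.sinh (dist c₂ c₁) * Real.sinh (dist x c₂) * Real.cosh r₂ := by
      have := Real.sinh_pos_iff.2 ht
      positivity
    refine lt_of_mul_lt_mul_left ?_ (Real.cosh_pos (dist x c₂)).le
    linarith
  · intro hlt
    obtain ⟨τ, hτ⟩ : ∃ τ, τ = (Real.cosh r₂ * Real.cosh (dist c₂ c₁) - Real.cosh r₁) /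
      (Real.cosh r₂ * Real.sinh (dist c₂ c₁)) := ⟨_, rfl⟩
    have hτ0 : 0 < τ := by
      rw [hτ]
      exact div_pos (by linarith) (by positivity)
    have hτ1 : τ < 1 := by
      have hexp : Real.cosh r₂ < Real.cosh r₁ * Real.exp (dist c₂ c₁) :=
        (Real.cosh_le_cosh_mul_exp_abs_sub r₂ r₁).trans_lt
          (mul_lt_mul_of_pos_left (Real.exp_lt_exp.2 h) (Real.cosh_pos _))
      rw [hτ, div_lt_one (by positivity)]
      have h3 := mul_lt_mul_of_pos_right hexp (Real.exp_pos (-dist c₂ c₁))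
      rw [mul_assoc, ← Real.exp_add, add_neg_cancel, Real.exp_zero,
        ← Real.cosh_sub_sinh] at h3
      linarith
    have hτmem : τ ∈ Set.Ioo (-1 : ℝ) 1 := ⟨by linarith, hτ1⟩
    have htanh := Real.tanh_artanh hτmem
    have ht : 0 < Real.artanh τ := Real.artanh_pos ⟨hτ0, hτ1⟩
    generalize Real.artanh τ = t at htanh ht
    obtain ⟨x, hx₂, hx₁⟩ := exists_dist_eq_and_dist_eq_abs_sub (dist_pos.1 hd) ht.le
    refine ⟨x, dist_pos.1 (hx₂ ▸ ht), ?_, ?_⟩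
    · rw [dist_comm c₂ x, dist_comm c₁ x, hx₂, hx₁]
      rcases abs_cases (dist c₂ c₁ - t) with ⟨h', -⟩ | ⟨h', -⟩
      · left; linarith
      · right; linarith
    · rw [hx₁, hx₂, Real.cosh_abs, Real.cosh_sub]
      have := Real.cosh_pos t
      rw [hτ, Real.tanh_eq_sinh_div_cosh, div_eq_div_iff (by positivity) (by positivity)] at htanh
      linarith
end

section
/- Let c₁, c₂ be points of the hyperbolic upper half-plane and r₁, r₂ > 0. Set pᵢ := cᵢ.re + cᵢ.im · Real.cosh rᵢ · Complex.I and ρᵢ := cᵢ.im · Real.sinh rᵢ. Then Real.cosh (dist c₁ c₂) = Real.cosh r₁ · Real.cosh r₂ if and only if the two hyperbolic circles intersect orthogonally, i.e. there exists z ∈ ℂ with dist z p₁ = ρ₁, dist z p₂ = ρ₂ and ((z − p₁) * conj (z − p₂)).re = 0. -/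
open UpperHalfPlane Complex ComplexConjugate

/-- Two Euclidean circles intersect orthogonally iff the squared distance of their centers is the
sum of the squares of their radii. -/
theorem exists_orthogonal_intersection_iff_dist_sq (p q : ℂ) {a b : ℝ} (ha : 0 < a) (hb : 0 < b) :
    (∃ z : ℂ, dist z p = a ∧ dist z q = b ∧ ((z - p) * conj (z - q)).re = 0) ↔
      dist p q ^ 2 = a ^ 2 + b ^ 2 := by
  constructor
  · rintro ⟨z, rfl, rfl, h⟩
    simp only [Complex.dist_eq, Complex.sq_norm, normSq_apply, mul_re, sub_re, sub_im, conj_re,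
      conj_im] at h ⊢
    linear_combination -2 * h
  · intro h
    set w : ℂ := a - b * Complex.I with hw
    have hw_sq : ‖w‖ ^ 2 = a ^ 2 + b ^ 2 := by
      simp [hw, Complex.sq_norm, normSq_apply]
      ring
    have hw_ne : w ≠ 0 := by
      rintro h0
      rw [h0, norm_zero] at hw_sq
      nlinarith [sq_nonneg b, pow_pos ha 2]
    have h_norm : ‖q - p‖ = ‖w‖ := by
      rw [← sq_eq_sq₀ (norm_nonneg _) (norm_nonneg _), hw_sq, ← h, dist_comm, Complex.dist_eq]
    set t : ℂ := (q - p) / w with ht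
    have ht_norm : ‖t‖ = 1 := by
      rw [ht, norm_div, h_norm, div_self (norm_ne_zero_iff.mpr hw_ne)]
    have hq : q = p + t * w := by
      rw [ht, div_mul_cancel₀ _ hw_ne]
      ring
    have hzq : p + a * t - q = b * (t * Complex.I) := by
      rw [hq, hw]
      ring
    refine ⟨p + a * t, ?_, ?_, ?_⟩
    · rw [Complex.dist_eq, add_sub_cancel_left, norm_mul, ht_norm, norm_real, mul_one,
        Real.norm_of_nonneg ha.le]
    · rw [Complex.dist_eq, hzq, norm_mul, norm_mul, ht_norm, Complex.norm_I, norm_real, mul_one, mul_one,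
        Real.norm_of_nonneg hb.le]
    · rw [add_sub_cancel_left, hzq]
      simp
      ring

/-- The orthogonality criterion of the paper's Proposition 2.5 (circle case):
two hyperbolic circles intersect orthogonally if and only if
`cosh (dist c₁ c₂) = cosh r₁ · cosh r₂` (i.e. `⟨C₁,C₂⟩ = −1`). -/
theorem circles_orthogonal_iff_cosh_eq (c₁ c₂ : UpperHalfPlane) (r₁ r₂ : ℝ)
    (h₁ : 0 < r₁) (h₂ : 0 < r₂) :
    Real.cosh (dist c₁ c₂) = Real.cosh r₁ * Real.cosh r₂ ↔
      ∃ z : ℂ,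
        dist z ((c₁.re : ℂ) + (c₁.im * Real.cosh r₁ : ℝ) * Complex.I) =
            c₁.im * Real.sinh r₁ ∧
        dist z ((c₂.re : ℂ) + (c₂.im * Real.cosh r₂ : ℝ) * Complex.I) =
            c₂.im * Real.sinh r₂ ∧
        ((z - ((c₁.re : ℂ) + (c₁.im * Real.cosh r₁ : ℝ) * Complex.I)) *
            conj (z - ((c₂.re : ℂ) + (c₂.im * Real.cosh r₂ : ℝ) * Complex.I))).re = 0 := by
  rw [exists_orthogonal_intersection_iff_dist_sq _ _
      (mul_pos c₁.im_pos (Real.sinh_pos_iff.mpr h₁)) (mul_pos c₂.im_pos (Real.sinh_pos_iff.mpr h₂)),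
    UpperHalfPlane.cosh_dist', div_eq_iff (by have := c₁.im_pos; have := c₂.im_pos; positivity),
    Complex.dist_eq, Complex.sq_norm, normSq_apply]
  simp only [sub_re, sub_im, add_re, add_im, mul_re, mul_im, ofReal_re, ofReal_im, Complex.I_re,
    Complex.I_im,
    mul_pow, Real.sinh_sq]
  constructor <;> intro h <;> linear_combination h
end

section
/- The map sending (w, r) ∈ UpperHalfPlane × {r : ℝ | r > 0} to (Real.cosh r)⁻¹ • ι w is a bijection onto the set {s : Fin 3 → ℝ | −1 < B s s ∧ B s s < 0 ∧ s 0 > 0}. -/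
open UpperHalfPlane

lemma B_smul_smul (c : ℝ) (x : Fin 3 → ℝ) : B (c • x) (c • x) = c ^ 2 * B x x := by
  simp only [B, Pi.smul_apply, smul_eq_mul]
  ring

lemma ι_apply_zero_pos (z : UpperHalfPlane) : 0 < ι z 0 := by
  have hz := z.im_pos
  simp only [ι, Matrix.cons_val_zero]
  positivity

lemma B_ι_self (z : UpperHalfPlane) : B (ι z) (ι z) = -1 := by
  have hz := z.im_ne_zero
  simp only [B, ι, Matrix.cons_val]
  field_simp
  ring

lemma ι_apply_zero_add_two (z : UpperHalfPlane) : ι z 0 + ι z 2 = z.im⁻¹ := by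
  have hz := z.im_ne_zero
  simp only [ι, Matrix.cons_val]
  field_simp
  ring

lemma ι_injective : Function.Injective ι := by
  intro z w h
  have him : z.im = w.im := by
    rw [← inv_inj, ← ι_apply_zero_add_two, ← ι_apply_zero_add_two, h]
  have hre : z.re / z.im = w.re / w.im := congrFun h 1
  rw [him, div_left_inj' w.im_ne_zero] at hre
  exact UpperHalfPlane.ext (Complex.ext hre him)

lemma exists_ι_eq {x : Fin 3 → ℝ} (hB : B x x = -1) (h0 : 0 < x 0) :
    ∃ z : UpperHalfPlane, ι z = x := by
  unfold B at hB
  have hpos : 0 < x 0 + x 2 := by nlinarith [sq_nonneg (x 1)]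
  refine ⟨⟨⟨x 1 / (x 0 + x 2), (x 0 + x 2)⁻¹⟩, inv_pos.2 hpos⟩, ?_⟩
  have hne := hpos.ne'
  ext i
  fin_cases i
  · simp only [ι, UpperHalfPlane.re, UpperHalfPlane.im, Fin.zero_eta, Matrix.cons_val]
    field_simp
    linear_combination hB
  · simp only [ι, UpperHalfPlane.re, UpperHalfPlane.im, Fin.mk_one, Matrix.cons_val]
    field_simp
  · simp only [ι, UpperHalfPlane.re, UpperHalfPlane.im, Fin.reduceFinMk, Matrix.cons_val]
    field_simp
    linear_combination -hB

/-- The hyperbolic-circle part of the paper's Proposition 2.5: sending a decorated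
point `(w, r)` (center and positive radius) to the normalized representative
`(cosh r)⁻¹ • ι w` is a bijection onto the vectors `s` with `−1 < B s s < 0` and
`s 0 > 0`. -/
theorem circle_representatives_bijection :
    Set.BijOn (fun p : UpperHalfPlane × ℝ => (Real.cosh p.2)⁻¹ • ι p.1)
      (Set.univ ×ˢ {r : ℝ | 0 < r})
      {s : Fin 3 → ℝ | -1 < B s s ∧ B s s < 0 ∧ 0 < s 0} := by
  refine ⟨?_, ?_, ?_⟩
  · rintro ⟨w, r⟩ ⟨-, hr⟩
    have hcosh : 1 < Real.cosh r := Real.one_lt_cosh.2 (ne_of_gt hr)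
    have hc : 0 < (Real.cosh r)⁻¹ := inv_pos.2 (Real.cosh_pos r)
    have hc1 : (Real.cosh r)⁻¹ < 1 := inv_lt_one_of_one_lt₀ hcosh
    simp only [Set.mem_ofPred_eq, B_smul_smul, B_ι_self]
    exact ⟨by nlinarith, by nlinarith, mul_pos hc (ι_apply_zero_pos w)⟩
  · rintro ⟨w, r⟩ ⟨-, hr⟩ ⟨w', r'⟩ ⟨-, hr'⟩ h
    simp only [Set.mem_ofPred_eq] at h hr hr'
    have hc : 0 < (Real.cosh r)⁻¹ := inv_pos.2 (Real.cosh_pos r)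
    have hc' : 0 < (Real.cosh r')⁻¹ := inv_pos.2 (Real.cosh_pos r')
    have hB := congrArg (fun s => B s s) h
    simp only [B_smul_smul, B_ι_self, mul_neg, mul_one, neg_inj] at hB
    have hcc : (Real.cosh r)⁻¹ = (Real.cosh r')⁻¹ :=
      (pow_left_inj₀ hc.le hc'.le two_ne_zero).1 hB
    have hrr : r = r' := by
      rw [← Real.arcosh_cosh (le_of_lt hr), ← Real.arcosh_cosh (le_of_lt hr'), inv_inj.1 hcc]
    rw [hcc] at h
    rw [hrr, ι_injective (smul_right_injective _ hc'.ne' h)]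
  · rintro s ⟨h1, h2, h0⟩
    have hc : 0 < √(-B s s) := Real.sqrt_pos.2 (by linarith)
    have hc1 : √(-B s s) < 1 := (Real.sqrt_lt' one_pos).2 (by linarith)
    have hsq : √(-B s s) ^ 2 = -B s s := Real.sq_sqrt (by linarith)
    have hinv : 1 < (√(-B s s))⁻¹ := (one_lt_inv₀ hc).2 hc1
    obtain ⟨w, hw⟩ : ∃ w, ι w = (√(-B s s))⁻¹ • s := by
      refine exists_ι_eq ?_ (mul_pos (inv_pos.2 hc) h0)
      rw [B_smul_smul, inv_pow, hsq, inv_neg, neg_mul, inv_mul_cancel₀ h2.ne]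
    refine ⟨(w, Real.arcosh (√(-B s s))⁻¹), ⟨trivial, Real.arcosh_pos hinv⟩, ?_⟩
    simp only
    rw [Real.cosh_arcosh hinv.le, inv_inv, hw, smul_inv_smul₀ hc.ne']
end

section
/- Let V be a real vector space and B a symmetric bilinear form on V. Let C₁, C₂, C₃, F, X ∈ V and α₁, α₂, α₃ ≥ 0 with X = α₁ • C₁ + α₂ • C₂ + α₃ • C₃. Assume B F C₁ = B F C₂ = B F C₃ = −1, B F X ≤ −1, and B X X > −1. Then there exists n ∈ {1, 2, 3} with B Cₙ X > −1. -/
/-- The paper's Lemma 2.16: if `X = α₁C₁ + α₂C₂ + α₃C₃` with nonnegative coefficients,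
`B F Cᵢ = −1` for all `i`, `B F X ≤ −1` and `B X X > −1`, then `B Cₙ X > −1` for
some `n`. -/
theorem exists_pairing_gt_neg_one
    (V : Type*) [AddCommGroup V] [Module ℝ V]
    (B : V →ₗ[ℝ] V →ₗ[ℝ] ℝ) (hsymm : ∀ x y : V, B x y = B y x)
    (C₁ C₂ C₃ F X : V) (α₁ α₂ α₃ : ℝ)
    (hα₁ : 0 ≤ α₁) (hα₂ : 0 ≤ α₂) (hα₃ : 0 ≤ α₃)
    (hX : X = α₁ • C₁ + α₂ • C₂ + α₃ • C₃)
    (hF₁ : B F C₁ = -1) (hF₂ : B F C₂ = -1) (hF₃ : B F C₃ = -1)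
    (hFX : B F X ≤ -1) (hXX : B X X > -1) :
    B C₁ X > -1 ∨ B C₂ X > -1 ∨ B C₃ X > -1 := by
  by_contra! h
  obtain ⟨h₁, h₂, h₃⟩ := h
  have hFsum := congrArg (fun Y => B F Y) hX
  have hXsum := congrArg (fun Y => B Y X) hX
  simp only [map_add, map_smul, LinearMap.add_apply, LinearMap.smul_apply, smul_eq_mul,
    hF₁, hF₂, hF₃] at hFsum hXsum
  linarith [mul_le_mul_of_nonneg_left h₁ hα₁, mul_le_mul_of_nonneg_left h₂ hα₂,
    mul_le_mul_of_nonneg_left h₃ hα₃]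
end

section
/- Let V be a real vector space and B a symmetric bilinear form on V. Let L, C₂, C₃ ∈ V with B L C₂ = 0 and B L C₃ = 0. Let C₁ = α • L + α₂ • C₂ + α₃ • C₃ and C₄ = α' • L + α'₂ • C₂ + α'₃ • C₃ with α < 0 < α'. Let F_left, F_right ∈ V satisfy B F_left C₁ = B F_left C₂ = B F_left C₃ = −1 and B F_right C₂ = B F_right C₃ = B F_right C₄ = −1. Define the tilts t_left := B F_left L and t_right := −(B F_right L). Then the following are equivalent: (i) B C₄ F_left ≤ −1; (ii) B C₁ F_right ≤ −1; (iii) t_left + t_right ≤ 0. -/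
/-- Two functionals that agree on `X` and `Y` differ on `a • L + b • X + c • Y` by `a` times
their difference on `L`. -/
theorem LinearMap.apply_add_smul_eq_of_eq {R M : Type*} [CommRing R] [AddCommGroup M] [Module R M]
    {f g : M →ₗ[R] R} {X Y : M} (hX : f X = g X) (hY : f Y = g Y) (L : M) (a b c : R) :
    f (a • L + b • X + c • Y) = g (a • L + b • X + c • Y) + a * (f L - g L) := by
  simp only [map_add, map_smul, smul_eq_mul, hX, hY]
  ring

/-- The algebraic content of the paper's Proposition 2.20: for a triangulated decorated
quadrilateral with vertex cycles `C₁, C₂, C₃, C₄` (the diagonal supported by `L` with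
`B L C₂ = B L C₃ = 0` and `B L C₁ < 0 < B L C₄`) and face-vectors `F_left`, `F_right`,
the two inequalities of the local Delaunay condition are equivalent to each other and
to the tilt inequality `t_left + t_right ≤ 0`, where `t_left = B F_left L` and
`t_right = −(B F_right L)`. -/
theorem local_delaunay_iff_tilts_nonpos
    (V : Type*) [AddCommGroup V] [Module ℝ V]
    (B : V →ₗ[ℝ] V →ₗ[ℝ] ℝ) (hsymm : ∀ x y : V, B x y = B y x)
    (L C₁ C₂ C₃ C₄ F_left F_right : V)
    (α α' α₂ α₃ α₂' α₃' : ℝ)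
    (hL₂ : B L C₂ = 0) (hL₃ : B L C₃ = 0)
    (hC₁ : C₁ = α • L + α₂ • C₂ + α₃ • C₃)
    (hC₄ : C₄ = α' • L + α₂' • C₂ + α₃' • C₃)
    (hα : α < 0) (hα' : 0 < α')
    (hFl₁ : B F_left C₁ = -1) (hFl₂ : B F_left C₂ = -1) (hFl₃ : B F_left C₃ = -1)
    (hFr₂ : B F_right C₂ = -1) (hFr₃ : B F_right C₃ = -1) (hFr₄ : B F_right C₄ = -1) :
    (B C₄ F_left ≤ -1 ↔ B C₁ F_right ≤ -1) ∧
      (B C₁ F_right ≤ -1 ↔ B F_left L + -(B F_right L) ≤ 0) := by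
  have h₁ : B C₁ F_right = -1 + α * (B F_right L - B F_left L) := by
    rw [hsymm, ← hFl₁, hC₁]
    exact LinearMap.apply_add_smul_eq_of_eq (hFr₂.trans hFl₂.symm) (hFr₃.trans hFl₃.symm) ..
  have h₄ : B C₄ F_left = -1 + α' * (B F_left L - B F_right L) := by
    rw [hsymm, ← hFr₄, hC₄]
    exact LinearMap.apply_add_smul_eq_of_eq (hFl₂.trans hFr₂.symm) (hFl₃.trans hFr₃.symm) ..
  have right_iff : B C₁ F_right ≤ -1 ↔ B F_left L + -(B F_right L) ≤ 0 := by
    rw [h₁, add_le_iff_nonpos_right, ← neg_mul_neg, ← smul_eq_mul,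
      smul_nonpos_iff_nonpos_of_pos_left (neg_pos.2 hα),
      neg_sub, sub_eq_add_neg]
  have left_iff : B C₄ F_left ≤ -1 ↔ B F_left L + -(B F_right L) ≤ 0 := by
    rw [h₄, add_le_iff_nonpos_right, ← smul_eq_mul,
      smul_nonpos_iff_nonpos_of_pos_left hα', sub_eq_add_neg]
  exact ⟨left_iff.trans right_iff.symm, right_iff⟩
end

section
/- Let V be a real vector space and B a symmetric bilinear form on V. Let C₀, C₁ ∈ V with B C₀ C₀ ≥ −1, B C₁ C₁ ≥ −1 and B C₀ C₁ < −1. Then B (C₁ − C₀) (C₁ − C₀) > 0, and the quadratic function Q(λ) := B (C₀ + λ • (C₁ − C₀)) (C₀ + λ • (C₁ − C₀)) attains its minimum at the unique point λ* = −(B C₀ (C₁ − C₀)) / (B (C₁ − C₀) (C₁ − C₀)), which satisfies 0 < λ* < 1. -/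
/-- Completing the square for a symmetric bilinear form along the line `x + t • v`. -/
theorem bilin_line_eq_add_sq {V : Type*} [AddCommGroup V] [Module ℝ V]
    (B : V →ₗ[ℝ] V →ₗ[ℝ] ℝ) (hsymm : ∀ x y : V, B x y = B y x)
    (x v : V) (hv : B v v ≠ 0) (t : ℝ) :
    B (x + t • v) (x + t • v) =
      B (x + (-(B x v) / B v v) • v) (x + (-(B x v) / B v v) • v) +
        B v v * (t - -(B x v) / B v v) ^ 2 := by
  simp only [map_add, map_smul, LinearMap.add_apply, LinearMap.smul_apply, smul_eq_mul,
    hsymm v x]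
  field_simp
  ring

/-- The paper's Lemma 3.9: for representatives `C₀, C₁` with `B Cᵢ Cᵢ ≥ −1` and
`B C₀ C₁ < −1`, the difference `C₁ − C₀` is spacelike, and the Minkowski norm along
the affine segment attains its minimum at the unique point
`λ* = −B C₀ (C₁−C₀) / B (C₁−C₀) (C₁−C₀)`, which lies strictly between 0 and 1. -/
theorem pencil_argmin
    (V : Type*) [AddCommGroup V] [Module ℝ V]
    (B : V →ₗ[ℝ] V →ₗ[ℝ] ℝ) (hsymm : ∀ x y : V, B x y = B y x)
    (C₀ C₁ : V) (h₀ : B C₀ C₀ ≥ -1) (h₁ : B C₁ C₁ ≥ -1) (h01 : B C₀ C₁ < -1) :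
    0 < B (C₁ - C₀) (C₁ - C₀) ∧
      let Q : ℝ → ℝ := fun lam => B (C₀ + lam • (C₁ - C₀)) (C₀ + lam • (C₁ - C₀))
      let lamStar : ℝ := -(B C₀ (C₁ - C₀)) / B (C₁ - C₀) (C₁ - C₀)
      (0 < lamStar ∧ lamStar < 1) ∧
        (∀ lam : ℝ, Q lamStar ≤ Q lam) ∧
        ∀ lam : ℝ, (∀ μ : ℝ, Q lam ≤ Q μ) → lam = lamStar := by
  have hx : B C₀ (C₁ - C₀) = B C₀ C₁ - B C₀ C₀ := map_sub _ _ _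
  have hv : B (C₁ - C₀) (C₁ - C₀) = B C₀ C₀ + B C₁ C₁ - 2 * B C₀ C₁ := by
    simp only [map_sub, LinearMap.sub_apply, hsymm C₁ C₀]
    ring
  have hpos : 0 < B (C₁ - C₀) (C₁ - C₀) := by linarith
  have hQ := bilin_line_eq_add_sq B hsymm C₀ (C₁ - C₀) hpos.ne'
  refine ⟨hpos, ⟨div_pos (by linarith) hpos, (div_lt_one hpos).2 (by linarith)⟩,
    fun lam => ?_, fun lam hlam => ?_⟩
  · have := mul_nonneg hpos.le (sq_nonneg (lam - -(B C₀ (C₁ - C₀)) / B (C₁ - C₀) (C₁ - C₀)))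
    linarith [hQ lam]
  · have hle := hlam (-(B C₀ (C₁ - C₀)) / B (C₁ - C₀) (C₁ - C₀))
    by_contra hne
    have := mul_pos hpos (pow_pos (abs_pos.2 (sub_ne_zero.2 hne)) 2)
    rw [sq_abs] at this
    linarith [hQ lam]
end
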